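/- arXiv:1912.08028 — 6 statements merged into one kernel-verified Lean document; each statement's English description precedes it below -/
import Mathlib

section
/- Let G be a finite simple graph containing edges xy and x'y' whose four endpoints x, y, x', y' are pairwise distinct and pairwise adjacent in G (i.e., the crossing of xy and x'y' is full). Let G' be the graph obtained from G by deleting the edges xy and x'y' and adding a new vertex v adjacent exactly to x, y, x', y'. If G' has a Hamiltonian cycle, then G has a Hamiltonian cycle. -/
open SimpleGraph

/-- The graph obtained from `G` by deleting the edges `xy` and `x'y'` and adding a new
vertex (`none`) adjacent exactly to `x`, `y`, `x'`, `y'`. -/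
def addCrossingVertex {V : Type*} (G : SimpleGraph V) (x y x' y' : V) :
    SimpleGraph (Option V) :=
  SimpleGraph.map Function.Embedding.some (G.deleteEdges {s(x, y), s(x', y')}) ⊔
    SimpleGraph.fromEdgeSet {s((none : Option V), some x), s(none, some y),
      s(none, some x'), s(none, some y')}

theorem addCrossingVertex_adj_some {V : Type*} {G : SimpleGraph V} {x y x' y' u w : V}
    (h : (addCrossingVertex G x y x' y').Adj (some u) (some w)) : G.Adj u w := by
  simp [addCrossingVertex, SimpleGraph.map_adj'] at h
  grind

theorem addCrossingVertex_adj_none {V : Type*} {G : SimpleGraph V} {x y x' y' u : V}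
    (h : (addCrossingVertex G x y x' y').Adj none (some u)) :
    u = x ∨ u = y ∨ u = x' ∨ u = y' := by
  simp [addCrossingVertex, SimpleGraph.map_adj'] at h
  grind

/-- A walk avoiding `none` descends along `some` to any graph containing the edges between
vertices of the form `some u`. -/
theorem exists_walk_of_none_notMem_support {V : Type*} {G : SimpleGraph V}
    {H : SimpleGraph (Option V)} (hH : ∀ ⦃u w⦄, H.Adj (some u) (some w) → G.Adj u w) {a b : V}
    (p : H.Walk (some a) (some b)) (hp : none ∉ p.support) :
    ∃ q : G.Walk a b, q.support.map some = p.support := by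
  generalize ha : some a = a' at p
  generalize hb : some b = b' at p
  induction p generalizing a with
  | nil =>
    obtain rfl : a = b := Option.some_injective _ (ha.trans hb.symm)
    exact ⟨.nil, by simp [ha]⟩
  | @cons _ c _ h r ih =>
    subst ha hb
    simp only [Walk.support_cons, List.mem_cons, not_or] at hp
    cases c with
    | none => exact absurd r.start_mem_support hp.2
    | some c =>
      obtain ⟨q, hq⟩ := ih rfl rfl hp.2
      exact ⟨.cons (hH h) q, by simp [hq]⟩

/-- A Hamiltonian path on at least three vertices with adjacent ends closes up to a
Hamiltonian cycle. -/
theorem SimpleGraph.Walk.IsHamiltonian.isHamiltonianCycle_cons {V : Type*} [Fintype V]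
    [DecidableEq V] {G : SimpleGraph V} {a b : V} {p : G.Walk a b} (hp : p.IsHamiltonian)
    (h : G.Adj b a) (hV : 3 ≤ Fintype.card V) : (Walk.cons h p).IsHamiltonianCycle := by
  have hl := hp.length_eq
  refine Walk.isHamiltonianCycle_iff_isCycle_and_length_eq.mpr
    ⟨(p.cons_isCycle_iff h).mpr ⟨hp.isPath, fun he ↦ ?_⟩, by simp; lia⟩
  have := hp.isPath.length_eq_one_of_mem_edges (Sym2.eq_swap ▸ he)
  lia

/-- If the crossing of `xy` and `x'y'` is full (the four pairwise distinct endpoints are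
pairwise adjacent) and the graph `G'` obtained by turning the crossing into a new 4-valent
vertex has a Hamiltonian cycle, then `G` has a Hamiltonian cycle. -/
theorem full_crossing_hamiltonian_cycle {V : Type*} [Fintype V] [DecidableEq V]
    (G : SimpleGraph V) (x y x' y' : V)
    (hxy : x ≠ y) (hxx' : x ≠ x') (hxy' : x ≠ y') (hyx' : y ≠ x') (hyy' : y ≠ y')
    (hx'y' : x' ≠ y')
    (e1 : G.Adj x y) (e2 : G.Adj x' y')
    (f1 : G.Adj x x') (f2 : G.Adj x y') (f3 : G.Adj y x') (f4 : G.Adj y y')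
    (hham : ∃ (a : Option V) (p : (addCrossingVertex G x y x' y').Walk a a),
      p.IsHamiltonianCycle) :
    ∃ (a : V) (p : G.Walk a a), p.IsHamiltonianCycle := by
  have hV : 3 ≤ Fintype.card V := by
    have h3 : ({x, y, x'} : Finset V).card = 3 := by simp [*]
    exact h3 ▸ Finset.card_le_univ _
  obtain ⟨_, p, hp⟩ := hham
  replace hp := hp.rotate (hp.mem_support none)
  generalize p.rotate none _ = c at hp
  have hcyc := hp.isCycle
  have hlen := hp.length_eq
  rw [Fintype.card_option] at hlen
  rcases c with _ | @⟨_, b, _, hb, q⟩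
  · simp at hlen
  rw [Walk.cons_isCycle_iff] at hcyc
  have hpath := hcyc.1.reverse
  have hqlen : q.reverse.length = Fintype.card V := by simpa using hlen
  generalize q.reverse = r at hpath hqlen
  rcases r with _ | @⟨_, c, _, hc, r⟩
  · simp at hqlen; lia
  rw [Walk.cons_isPath_iff] at hpath
  rcases b with _ | b
  · exact absurd hb (SimpleGraph.irrefl _)
  rcases c with _ | c
  · exact absurd hc (SimpleGraph.irrefl _)
  obtain ⟨t, ht⟩ := exists_walk_of_none_notMem_support
    (fun _ _ ↦ addCrossingVertex_adj_some) r hpath.2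
  have htlen : t.length + 1 = Fintype.card V := by
    rw [← hqlen, Walk.length_cons, ← Walk.length_support, ← Walk.length_support, ← ht,
      List.length_map]
  have htpath : t.IsPath := by
    have := hpath.1.support_nodup
    rw [← ht] at this
    exact .mk' this.of_map
  have htham : t.IsHamiltonian :=
    Walk.isHamiltonian_iff_isPath_and_length_eq.mpr ⟨htpath, by lia⟩
  have hne : b ≠ c := by
    rintro rfl
    have := Walk.length_eq_zero_iff.mpr (Walk.isPath_iff_nil.mp htpath)
    lia
  have hadj : G.Adj b c := by
    rcases addCrossingVertex_adj_none hb with rfl | rfl | rfl | rfl <;>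
    rcases addCrossingVertex_adj_none hc with rfl | rfl | rfl | rfl <;>
    first | exact absurd rfl hne | assumption | (apply SimpleGraph.Adj.symm; assumption)
  exact ⟨b, _, htham.isHamiltonianCycle_cons hadj hV⟩
end

section
/- Let G be a finite simple graph containing edges xy and x'y' whose four endpoints x, y, x', y' are pairwise distinct and pairwise adjacent in G (i.e., the crossing of xy and x'y' is full). Let G' be the graph obtained from G by deleting the edges xy and x'y' and adding a new vertex v adjacent exactly to x, y, x', y'. If G' has a Hamiltonian path, then G has a Hamiltonian path. -/
open SimpleGraph

/-- A Hamiltonian path of a graph on `Option V` restricts to one of `G` by skipping the vertex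
`none`, provided that the neighbours of `none` form a clique in `G` and all other adjacencies
come from `G`. -/
theorem exists_isHamiltonian_of_isClique_option {V : Type*} [Nonempty V] [DecidableEq V]
    {G : SimpleGraph V} {H : SimpleGraph (Option V)}
    (hH : ∀ u w, H.Adj (some u) (some w) → G.Adj u w)
    (hclique : G.IsClique {u | H.Adj none (some u)})
    {a b : Option V} {p : H.Walk a b} (hp : p.IsHamiltonian) :
    ∃ (a b : V) (q : G.Walk a b), q.IsHamiltonian := by
  obtain ⟨s, t, hst⟩ := List.append_of_mem (hp.mem_support none)
  have hnodup := hp.isPath.support_nodup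
  have hchain := p.isChain_adj_support
  rw [hst] at hnodup hchain
  have exists_map_some (l : List (Option V)) (hl : none ∉ l) : ∃ l' : List V, l'.map some = l := by
    change l ∈ Set.range (List.map some)
    rw [Set.range_list_map]
    rintro (_ | u) hu
    · exact absurd hu hl
    · exact ⟨u, rfl⟩
  obtain ⟨s, rfl⟩ := exists_map_some s (by grind)
  obtain ⟨t, rfl⟩ := exists_map_some t (by grind)
  have hmem (u : V) : u ∈ s ++ t := by
    simpa [hst] using hp.mem_support (some u)
  have hnodup' : (s ++ t).Nodup := by
    refine List.Nodup.of_map some ?_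
    rw [List.map_append]
    exact hnodup.sublist (List.sublist_cons_self _ _ |>.append_left _)
  have hne : s ++ t ≠ [] := by
    obtain ⟨u⟩ := ‹Nonempty V›
    intro h
    simpa [h] using hmem u
  have hG : (s ++ t).IsChain G.Adj := by
    rw [List.isChain_append, List.isChain_cons, List.isChain_map, List.isChain_map] at hchain
    obtain ⟨hA, ⟨hB, hB'⟩, hAB⟩ := hchain
    refine List.isChain_append.mpr ⟨hA.imp hH, hB'.imp hH, fun u hu w hw ↦ ?_⟩
    refine hclique (hAB (some u) (by simpa using hu) none (by simp)).symm
      (hB (some w) (by simpa using hw)) ?_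
    exact (List.nodup_append.mp hnodup').2.2 u (List.mem_of_mem_getLast? hu) w
      (List.mem_of_mem_head? hw)
  refine ⟨_, _, .ofSupport _ hne hG, fun u ↦ ?_⟩
  rw [Walk.support_ofSupport]
  exact List.count_eq_one_of_mem hnodup' (hmem u)

/-- If the crossing of `xy` and `x'y'` is full (the four pairwise distinct endpoints are
pairwise adjacent) and the graph `G'` obtained by turning the crossing into a new 4-valent
vertex has a Hamiltonian path, then `G` has a Hamiltonian path. -/
theorem full_crossing_hamiltonian_path {V : Type*} [Fintype V] [DecidableEq V]
    (G : SimpleGraph V) (x y x' y' : V)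
    (hxy : x ≠ y) (hxx' : x ≠ x') (hxy' : x ≠ y') (hyx' : y ≠ x') (hyy' : y ≠ y')
    (hx'y' : x' ≠ y')
    (e1 : G.Adj x y) (e2 : G.Adj x' y')
    (f1 : G.Adj x x') (f2 : G.Adj x y') (f3 : G.Adj y x') (f4 : G.Adj y y')
    (hham : ∃ (a b : Option V) (p : (addCrossingVertex G x y x' y').Walk a b),
      p.IsHamiltonian) :
    ∃ (a b : V) (p : G.Walk a b), p.IsHamiltonian := by
  obtain ⟨a, b, p, hp⟩ := hham
  have : Nonempty V := ⟨x⟩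
  refine exists_isHamiltonian_of_isClique_option (fun u w h ↦ ?_) ?_ hp
  · simp only [addCrossingVertex, SimpleGraph.sup_adj, SimpleGraph.map_adj,
      SimpleGraph.fromEdgeSet_adj] at h
    aesop
  · have hnone (u : V) (h : (addCrossingVertex G x y x' y').Adj none (some u)) :
        u = x ∨ u = y ∨ u = x' ∨ u = y' := by
      simpa [addCrossingVertex, SimpleGraph.map_adj'] using h
    intro u hu w hw huw
    rcases hnone u hu with rfl | rfl | rfl | rfl <;>
      rcases hnone w hw with rfl | rfl | rfl | rfl <;>
      first
        | exact absurd rfl huw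
        | assumption
        | exact SimpleGraph.Adj.symm ‹_›
end

section
/- Let H be a finite simple graph on at least 4 vertices that has a Hamiltonian cycle, and let u be a vertex of H whose neighbors are pairwise adjacent in H (the neighborhood of u induces a complete subgraph). Then the graph H − u obtained by deleting u has a Hamiltonian cycle that contains at least one edge joining two neighbors of u. -/
open SimpleGraph

/-- A Hamiltonian cycle based at `u` decomposes as a path on all vertices other than `u`
together with two edges at `u`. -/
theorem SimpleGraph.Walk.IsHamiltonianCycle.exists_isPath_not_mem {V : Type*} [Fintype V]
    [DecidableEq V] {G : SimpleGraph V} {u : V} {p : G.Walk u u} (hp : p.IsHamiltonianCycle) :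
    ∃ (v w : V) (r : G.Walk v w), G.Adj u v ∧ G.Adj u w ∧ r.IsPath ∧ u ∉ r.support ∧
      r.length + 2 = Fintype.card V := by
  have hlen := hp.length_eq
  have hc := hp.isCycle
  cases p with
  | nil => exact absurd rfl hc.ne_nil
  | cons h q =>
    have hq : q.IsPath := ((Walk.cons_isCycle_iff q h).1 hc).1
    cases q with
    | nil => exact absurd h (G.loopless.irrefl _)
    | cons h₁ q₁ =>
      obtain ⟨w, r, h₂, hr⟩ := Walk.exists_cons_eq_concat h₁ q₁
      rw [hr] at hq hlen
      rw [Walk.concat_isPath_iff] at hq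
      refine ⟨_, w, r, h, h₂.symm, hq.1, hq.2, ?_⟩
      simpa using hlen

/-- If `H` is a graph on at least 4 vertices with a Hamiltonian cycle and the neighborhood of
`u` induces a complete subgraph, then `H − u` has a Hamiltonian cycle containing at least one
edge joining two neighbors of `u`. -/
theorem delete_simplicial_vertex_hamiltonian_with_edge {V : Type*} [Fintype V] [DecidableEq V]
    (H : SimpleGraph V) (hcard : 4 ≤ Fintype.card V)
    (hham : ∃ (a : V) (p : H.Walk a a), p.IsHamiltonianCycle)
    (u : V) (hclique : ∀ a b : V, H.Adj u a → H.Adj u b → a ≠ b → H.Adj a b) :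
    ∃ (a : ({u}ᶜ : Set V)) (p : (H.induce ({u}ᶜ : Set V)).Walk a a),
      p.IsHamiltonianCycle ∧
        ∃ b c : ({u}ᶜ : Set V), s(b, c) ∈ p.edges ∧ H.Adj u ↑b ∧ H.Adj u ↑c := by
  obtain ⟨a, p, hp⟩ := hham
  obtain ⟨v, w, r, huv, huw, hr, hur, hlen⟩ := (hp.rotate (hp.mem_support u)).exists_isPath_not_mem
  have hmem : ∀ x ∈ r.support, x ∈ ({u}ᶜ : Set V) := by
    rintro x hx rfl
    exact hur hx
  have hvw : v ≠ w := by
    rintro rfl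
    rw [Walk.isPath_iff_nil] at hr
    have := Walk.length_eq_zero_iff.2 hr
    omega
  let r' := r.induce _ hmem
  have hmap : r'.map (Embedding.induce _).toHom = r := Walk.map_induce r hmem
  have hlen' : r'.length = r.length :=
    (Walk.length_map _ r').symm.trans (congrArg Walk.length hmap)
  have hpath : r'.IsPath := by
    apply Walk.IsPath.of_map (f := (Embedding.induce _).toHom)
    rwa [hmap]
  have hadj : (H.induce ({u}ᶜ : Set V)).Adj ⟨w, hmem w r.end_mem_support⟩
      ⟨v, hmem v r.start_mem_support⟩ := hclique w v huw huv hvw.symm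
  have hcycle : (Walk.cons hadj r').IsCycle := by
    refine (Walk.cons_isCycle_iff _ _).2 ⟨hpath, fun he ↦ ?_⟩
    rw [Sym2.eq_swap] at he
    have := hpath.length_eq_one_of_mem_edges he
    omega
  refine ⟨_, Walk.cons hadj r', Walk.isHamiltonianCycle_iff_isCycle_and_length_eq.2
    ⟨hcycle, ?_⟩, _, _, List.mem_cons_self, huw, huv⟩
  rw [Walk.length_cons, Fintype.card_compl_set, Set.card_singleton]
  omega
end

section
/- Let H be a finite simple graph on at least 2 vertices that has a Hamiltonian path, and let u be a vertex of H whose neighbors are pairwise adjacent in H (the neighborhood of u induces a complete subgraph). Then the graph H − u obtained by deleting u has a Hamiltonian path. -/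
open SimpleGraph

/-- Removing a simplicial vertex from a duplicate-free list of successively adjacent vertices
leaves a list of successively adjacent vertices. -/
lemma isChain_adj_append_of_simplicial {V : Type*} {H : SimpleGraph V} {u : V} {s t : List V}
    (hclique : ∀ a b : V, H.Adj u a → H.Adj u b → a ≠ b → H.Adj a b)
    (hnodup : (s ++ u :: t).Nodup) (hchain : (s ++ u :: t).IsChain H.Adj) :
    (s ++ t).IsChain H.Adj := by
  rw [List.isChain_append] at hchain ⊢
  obtain ⟨hs, hut, hsu⟩ := hchain
  rw [List.isChain_cons] at hut
  refine ⟨hs, hut.2, fun x hx y hy ↦ ?_⟩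
  refine hclique x y (hsu x hx u rfl).symm (hut.1 y hy) ?_
  exact (List.nodup_append.mp hnodup).2.2 x (List.mem_of_mem_getLast? hx) y
    (List.mem_cons_of_mem u (List.mem_of_mem_head? hy))

/-- If `H` is a graph on at least 2 vertices with a Hamiltonian path and the neighborhood of
`u` induces a complete subgraph, then `H − u` has a Hamiltonian path. -/
theorem delete_simplicial_vertex_traceable {V : Type*} [Fintype V] [DecidableEq V]
    (H : SimpleGraph V) (hcard : 2 ≤ Fintype.card V)
    (hham : ∃ (a b : V) (p : H.Walk a b), p.IsHamiltonian)
    (u : V) (hclique : ∀ a b : V, H.Adj u a → H.Adj u b → a ≠ b → H.Adj a b) :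
    ∃ (a b : ({u}ᶜ : Set V)) (p : (H.induce ({u}ᶜ : Set V)).Walk a b),
      p.IsHamiltonian := by
  obtain ⟨a, b, p, hp⟩ := hham
  obtain ⟨s, t, hst⟩ := List.append_of_mem (hp.mem_support u)
  have hnodup := hp.isPath.support_nodup
  have hchain := p.isChain_adj_support
  have hmem := hp.mem_support
  rw [hst] at hnodup hchain
  simp only [hst] at hmem
  have hchain' := isChain_adj_append_of_simplicial hclique hnodup hchain
  rw [List.nodup_middle, List.nodup_cons] at hnodup
  obtain ⟨l, hl⟩ : ∃ l : List ({u}ᶜ : Set V), l.map Subtype.val = s ++ t :=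
    ⟨(s ++ t).attachWith _ fun x hx h ↦ hnodup.1 (h ▸ hx), List.attachWith_map_subtype_val _⟩
  rw [← hl] at hchain'
  have hchainl : l.IsChain (H.induce ({u}ᶜ : Set V)).Adj :=
    (List.isChain_map Subtype.val).mp hchain'
  have hmem' : ∀ x, x ∈ l := fun x ↦ by
    have hx : x.val ∈ l.map Subtype.val := by
      have hxu : x.val ≠ u := x.2
      simpa [hl, hxu] using hmem x
    exact (List.mem_map_of_injective Subtype.val_injective).mp hx
  have hne : l ≠ [] := by
    have : Nontrivial V := Fintype.one_lt_card_iff_nontrivial.mp hcard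
    obtain ⟨v, hv⟩ := exists_ne u
    exact List.ne_nil_of_mem (hmem' ⟨v, hv⟩)
  refine ⟨_, _, Walk.ofSupport l hne hchainl, Walk.IsPath.isHamiltonian_of_mem ?_ fun x ↦ ?_⟩
  · rw [Walk.isPath_def, Walk.support_ofSupport]
    exact List.Nodup.of_map _ (hl ▸ hnodup.2)
  · rw [Walk.support_ofSupport]
    exact hmem' x
end

section
/- Let G be a finite simple graph and let v be a vertex of G with four distinct neighbors a, b, c, d such that ab and cd are edges of G. Suppose G has a Hamiltonian cycle C containing the edges av, vd, and bc. Then the graph obtained from G by deleting the vertex v and adding the edges ac and bd has a Hamiltonian cycle. -/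
open SimpleGraph

namespace SimpleGraph.Walk

variable {V : Type*} {G : SimpleGraph V}

/-- A walk through an edge splits at that edge. -/
theorem exists_eq_append_cons_of_mem_edges {u w : V} {e : Sym2 V} (p : G.Walk u w)
    (he : e ∈ p.edges) :
    ∃ (x y : V) (h : G.Adj x y) (q : G.Walk u x) (r : G.Walk y w),
      s(x, y) = e ∧ p = q.append (cons h r) := by
  induction p with
  | nil => simp at he
  | cons h p ih =>
    rw [edges_cons, List.mem_cons] at he
    rcases he with rfl | he
    · exact ⟨_, _, h, nil, p, rfl, rfl⟩
    · obtain ⟨x, y, h', q, r, hxy, rfl⟩ := ih he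
      exact ⟨x, y, h', cons h q, r, hxy, rfl⟩

/-- Replacing an edge `xy` of a Hamiltonian path from `a` to `d` by the chords `xd` and `ya`
closes the path up to a Hamiltonian cycle. -/
theorem IsHamiltonian.exists_isHamiltonianCycle_of_chords [DecidableEq V] {a d x y : V}
    {q : G.Walk a x} {r : G.Walk y d} {h : G.Adj x y}
    (hp : (q.append (cons h r)).IsHamiltonian) (had : a ≠ d) (hyd : y ≠ d)
    (hxd : G.Adj d x) (hay : G.Adj a y) :
    ∃ p : G.Walk a a, p.IsHamiltonianCycle := by
  have hsupp : (q.append (cons h r)).support = q.support ++ r.support := by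
    simp [support_append]
  have hnd : (q.support ++ r.support).Nodup := hsupp ▸ hp.isPath.support_nodup
  let p : G.Walk y a := r.append (cons hxd q.reverse)
  have hpsupp : p.support = r.support ++ q.support.reverse := by
    simp [p, support_append]
  have hham : p.IsHamiltonian := by
    intro z
    rw [hpsupp, List.count_append, List.count_reverse, add_comm, ← List.count_append, ← hsupp]
    exact hp z
  refine ⟨cons hay p, (cons_isCycle_iff p hay).2 ⟨hham.isPath, fun he ↦ ?_⟩, by simpa [IsHamiltonian] using hham⟩
  have hdisj := List.disjoint_of_nodup_append hnd
  simp only [p, edges_append, edges_cons, edges_reverse, List.mem_append, List.mem_cons,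
    List.mem_reverse] at he
  rcases he with he | he | he
  · exact hdisj q.start_mem_support (r.fst_mem_support_of_mem_edges he)
  · rcases Sym2.eq_iff.1 he with ⟨h₁, -⟩ | ⟨-, h₂⟩
    · exact had h₁
    · exact hyd h₂
  · exact hdisj (q.snd_mem_support_of_mem_edges he) r.start_mem_support

theorem IsHamiltonian.exists_isHamiltonianCycle_of_mem_edges [DecidableEq V] {a b c d : V}
    {p : G.Walk a d} (hp : p.IsHamiltonian) (hbc : s(b, c) ∈ p.edges) (had : a ≠ d)
    (hbd : b ≠ d) (hcd : c ≠ d) (heab : G.Adj a b) (heac : G.Adj a c) (hedb : G.Adj d b)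
    (hedc : G.Adj d c) : ∃ p : G.Walk a a, p.IsHamiltonianCycle := by
  obtain ⟨x, y, h, q, r, hxy, rfl⟩ := p.exists_eq_append_cons_of_mem_edges hbc
  rcases Sym2.eq_iff.1 hxy with ⟨rfl, rfl⟩ | ⟨rfl, rfl⟩
  · exact hp.exists_isHamiltonianCycle_of_chords had hcd hedb heac
  · exact hp.exists_isHamiltonianCycle_of_chords had hbd hedc heab

/-- Deleting a vertex `v` from a Hamiltonian cycle leaves a path between the two neighbors of `v`
on the cycle that visits all other vertices and keeps all edges not incident to `v`. -/
theorem IsHamiltonianCycle.exists_isPath_avoiding [DecidableEq V] {a d v w : V}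
    {C : G.Walk w w} (hC : C.IsHamiltonianCycle) (had : a ≠ d) (hav : s(a, v) ∈ C.edges)
    (hvd : s(v, d) ∈ C.edges) :
    ∃ p : G.Walk a d, p.IsPath ∧ (∀ z, z ∈ p.support ↔ z ≠ v) ∧
      ∀ e ∈ C.edges, v ∉ e → e ∈ p.edges := by
  have hv := hC.mem_support v
  have hedges (e : Sym2 V) (he : e ∈ C.edges) : e ∈ (C.rotate v hv).edges :=
    (C.rotate_edges v hv).mem_iff.2 he
  replace hC := hC.rotate hv
  replace hav := hedges _ hav
  replace hvd := hedges _ hvd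
  generalize C.rotate v hv = C' at *
  cases C' with
  | nil => simp at hav
  | @cons _ a' _ h₁ q =>
  obtain ⟨hqpath, hq⟩ := (cons_isCycle_iff q h₁).1 hC.isCycle
  have hham : q.IsHamiltonian := by simpa [IsHamiltonian] using hC.isHamiltonian_tail
  cases q using concatRec with
  | Hnil => exact (h₁.ne rfl).elim
  | @Hconcat _ d' _ p h₂ _ =>
  rw [isPath_def, support_concat, List.nodup_append] at hqpath
  have hvp : v ∉ p.support := fun h ↦ hqpath.2.2 v h v (by simp) rfl
  have hsupp (z : V) : z ∈ p.support ↔ z ≠ v := by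
    refine ⟨fun h hz ↦ hvp (hz ▸ h), fun h ↦ ?_⟩
    simpa [support_concat, h] using hham.mem_support z
  have hcases (e : Sym2 V) (he : e ∈ (cons h₁ (p.concat h₂)).edges) :
      e = s(v, a') ∨ e ∈ p.edges ∨ e = s(d', v) := by
    simpa [edges_concat] using he
  have hend (z : V) (hz : s(v, z) ∈ (cons h₁ (p.concat h₂)).edges) : z = a' ∨ z = d' := by
    rcases hcases _ hz with h | h | h
    · exact .inl (Sym2.congr_right.1 h)
    · exact (hvp (p.fst_mem_support_of_mem_edges h)).elim
    · exact .inr (Sym2.congr_right.1 (h.trans Sym2.eq_swap))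
  have hkeep (e : Sym2 V) (he : e ∈ C.edges) (hve : v ∉ e) : e ∈ p.edges := by
    rcases hcases e (hedges e he) with rfl | h | rfl
    · simp at hve
    · exact h
    · simp at hve
  have hp : p.IsPath := (isPath_def p).2 hqpath.1
  rcases hend a (Sym2.eq_swap ▸ hav) with rfl | rfl <;> rcases hend d hvd with rfl | rfl
  · exact (had rfl).elim
  · exact ⟨p, hp, hsupp, hkeep⟩
  · exact ⟨p.reverse, hp.reverse, by simpa using hsupp, by simpa using hkeep⟩
  · exact (had rfl).elim

end SimpleGraph.Walk

/-- Let `v` be a vertex of `G` with four distinct neighbors `a`, `b`, `c`, `d` such that `ab`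
and `cd` are edges of `G`. If `G` has a Hamiltonian cycle containing the edges `av`, `vd` and
`bc`, then the graph obtained from `G` by deleting `v` and adding the edges `ac` and `bd` has
a Hamiltonian cycle. -/
theorem reroute_hamiltonian_cycle {V : Type*} [Fintype V] [DecidableEq V]
    (G : SimpleGraph V) (v a b c d : V)
    (hab : a ≠ b) (hac : a ≠ c) (had : a ≠ d) (hbc : b ≠ c) (hbd : b ≠ d) (hcd : c ≠ d)
    (hva : G.Adj v a) (hvb : G.Adj v b) (hvc : G.Adj v c) (hvd : G.Adj v d)
    (heab : G.Adj a b) (hecd : G.Adj c d)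
    (w : V) (C : G.Walk w w) (hC : C.IsHamiltonianCycle)
    (hav : s(a, v) ∈ C.edges) (hvd' : s(v, d) ∈ C.edges) (hbc' : s(b, c) ∈ C.edges) :
    ∃ (x : ({v}ᶜ : Set V))
      (p : ((G.induce ({v}ᶜ : Set V)) ⊔ SimpleGraph.fromEdgeSet
        {s((⟨a, hva.ne'⟩ : ({v}ᶜ : Set V)), (⟨c, hvc.ne'⟩ : ({v}ᶜ : Set V))),
         s((⟨b, hvb.ne'⟩ : ({v}ᶜ : Set V)), (⟨d, hvd.ne'⟩ : ({v}ᶜ : Set V)))}).Walk x x),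
      p.IsHamiltonianCycle := by
  obtain ⟨p, hp, hsupp, hkeep⟩ := hC.exists_isPath_avoiding had hav hvd'
  have hpbc : s(b, c) ∈ p.edges := hkeep _ hbc' (by simp [hvb.ne, hvc.ne])
  have hs : ∀ z ∈ p.support, z ∈ ({v}ᶜ : Set V) := fun z hz ↦ (hsupp z).1 hz
  let p' := p.induce ({v}ᶜ : Set V) hs
  have hmap : p'.map (Embedding.induce ({v}ᶜ : Set V)).toHom = p := Walk.map_induce ..
  have hp' : p'.IsPath := Walk.IsPath.of_map (hmap.symm ▸ hp)
  have hham : p'.IsHamiltonian := hp'.isHamiltonian_of_mem fun z ↦ by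
    simpa [p', Walk.support_induce] using (hsupp z).2 z.2
  have hedge : s((⟨b, hvb.ne'⟩ : ({v}ᶜ : Set V)), ⟨c, hvc.ne'⟩) ∈ p'.edges := by
    have hedges : p'.edges.map (Sym2.map (Embedding.induce (G := G) ({v}ᶜ : Set V))) = p.edges :=
      (Walk.edges_map _ p').symm.trans (congrArg Walk.edges hmap)
    rw [← hedges] at hpbc
    exact (List.mem_map_of_injective
      (Sym2.map.injective (Embedding.induce (G := G) ({v}ᶜ : Set V)).injective)).1 hpbc
  refine ⟨_, Walk.IsHamiltonian.exists_isHamiltonianCycle_of_mem_edges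
    (p := p'.mapLe le_sup_left) (b := ⟨b, hvb.ne'⟩) (c := ⟨c, hvc.ne'⟩) ?_ ?_ ?_ ?_ ?_ ?_ ?_ ?_ ?_⟩
  · simpa [Walk.IsHamiltonian] using hham
  · simpa using hedge
  · exact fun h ↦ had (congrArg Subtype.val h)
  · exact fun h ↦ hbd (congrArg Subtype.val h)
  · exact fun h ↦ hcd (congrArg Subtype.val h)
  · simp [heab]
  · simp [Subtype.ext_iff, hac]
  · simp [Subtype.ext_iff, hbd.symm]
  · simp [hecd.symm]
end

section
/- Let G be a finite simple graph, let W be a set of vertices of G, and suppose: (i) for all distinct u, v ∈ W, every path in G from u to v all of whose internal vertices lie outside W and which has at least one internal vertex has at most three internal vertices and satisfies uv ∈ E(G); (ii) every connected component of the induced subgraph of G on V(G) \ W has at most three vertices; (iii) the induced subgraph G[W] contains a cycle. Then for every cycle C of G there exists a cycle C' of the induced subgraph G[W] with |V(C)| ≤ 4·|V(C')|; in particular, the circumference of G is at most 4 times the circumference of G[W]. -/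
open SimpleGraph

namespace SimpleGraph.Walk

variable {V : Type*} {G : SimpleGraph V}

/-- A walk ending in `W` splits at the first vertex of `W` that it visits. -/
lemma exists_eq_append_of_end_mem {W : Set V} {u v : V} (p : G.Walk u v) (hv : v ∈ W) :
    ∃ x ∈ W, ∃ (q : G.Walk u x) (r : G.Walk x v), p = q.append r ∧
      ∀ w ∈ q.support.dropLast, w ∉ W := by
  induction p with
  | nil => exact ⟨_, hv, nil, nil, rfl, by simp⟩
  | @cons u y v h p ih =>
    by_cases hu : u ∈ W
    · exact ⟨u, hu, nil, cons h p, rfl, by simp⟩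
    · obtain ⟨x, hx, q, r, rfl, hq⟩ := ih hv
      refine ⟨x, hx, cons h q, r, rfl, ?_⟩
      rw [support_cons, List.dropLast_cons_of_ne_nil q.support_ne_nil]
      simpa [hu] using hq

/-- A path inside `S` has at most `n` vertices if the components of `G[S]` have at most `n`. -/
lemma IsPath.length_lt_of_support_subset [Finite V] {S : Set V} {n : ℕ}
    (hS : ∀ c : (G.induce S).ConnectedComponent, c.supp.ncard ≤ n)
    {u v : V} {p : G.Walk u v} (hp : p.IsPath) (h : ∀ w ∈ p.support, w ∈ S) :
    p.length < n := by
  classical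
  let q := p.induce S h
  have hq : q.IsPath := by
    apply IsPath.of_map (f := (Embedding.induce S).toHom)
    rw [map_induce]
    exact hp
  have hlen : q.length = p.length := by
    rw [← length_map (Embedding.induce S).toHom q, map_induce]
    rfl
  have hsub : (q.support.toFinset : Set S) ⊆
      ((G.induce S).connectedComponentMk ⟨u, h u p.start_mem_support⟩).supp := by
    intro w hw
    rw [ConnectedComponent.mem_supp_iff, ConnectedComponent.eq]
    exact (q.takeUntil w (by simpa using hw)).reachable.symm
  have hcard := Set.ncard_le_ncard hsub (Set.toFinite _)
  rw [Set.ncard_coe_finset, List.toFinset_card_of_nodup hq.support_nodup, length_support,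
    hlen] at hcard
  exact Nat.lt_of_succ_le (hcard.trans (hS _))

/-- Closing up a path of length at least two by an edge yields a cycle. -/
lemma IsPath.isCycle_cons {u v : V} {p : G.Walk v u} (hp : p.IsPath) (h : G.Adj u v)
    (hlen : 2 ≤ p.length) : (cons h p).IsCycle := by
  refine (cons_isCycle_iff p h).mpr ⟨hp, fun he => ?_⟩
  have := hp.length_eq_one_of_mem_edges (Sym2.eq_swap ▸ he)
  omega

section Shortcut

variable {W : Set V} {n : ℕ}

lemma IsPath.length_cons_le_and_adj
    (hW : ∀ u ∈ W, ∀ v ∈ W, u ≠ v → ∀ p : G.Walk u v, p.IsPath →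
      (∀ w ∈ p.support.tail.dropLast, w ∉ W) → p.support.tail.dropLast ≠ [] →
      p.support.tail.dropLast.length ≤ n ∧ G.Adj u v)
    {u y x : V} {q : G.Walk y x} (hq : q.IsPath) (h : G.Adj u y) (hu : u ∈ W) (hx : x ∈ W)
    (hux : u ≠ x) (hqW : ∀ w ∈ q.support.dropLast, w ∉ W) :
    (cons h q).length ≤ n + 1 ∧ G.Adj u x := by
  have hlen : q.support.dropLast.length = q.length := by simp
  by_cases hnil : q.support.dropLast = []
  · rw [hnil, List.length_nil] at hlen
    obtain rfl := eq_of_length_eq_zero hlen.symm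
    exact ⟨by simp [← hlen], h⟩
  · have hu' : u ∉ q.support := by
      rw [← dropLast_support_concat q]
      simp only [List.mem_append, List.mem_singleton, not_or]
      exact ⟨fun hm => hqW u hm hu, hux⟩
    have := hW u hu x hx hux (cons h q) (hq.cons hu') (by simpa using hqW) (by simpa using hnil)
    rw [support_cons, List.tail_cons, hlen] at this
    exact ⟨by simpa using this.1, this.2⟩

/-- Replacing the excursions of a path outside `W` by edges yields a path in `G[W]`. -/
lemma IsPath.exists_isPath_induce
    (hW : ∀ u ∈ W, ∀ v ∈ W, u ≠ v → ∀ p : G.Walk u v, p.IsPath →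
      (∀ w ∈ p.support.tail.dropLast, w ∉ W) → p.support.tail.dropLast ≠ [] →
      p.support.tail.dropLast.length ≤ n ∧ G.Adj u v)
    {u v : V} {p : G.Walk u v} (hp : p.IsPath) (hu : u ∈ W) (hv : v ∈ W) :
    ∃ p' : (G.induce W).Walk ⟨u, hu⟩ ⟨v, hv⟩, p'.IsPath ∧
      (∀ w ∈ p'.support, (w : V) ∈ p.support) ∧ p.length ≤ (n + 1) * p'.length := by
  induction hl : p.length using Nat.strong_induction_on generalizing u with
  | _ l ih =>
  cases p with
  | nil => exact ⟨Walk.nil, IsPath.nil, by simp, by simp [← hl]⟩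
  | @cons _ y _ h p =>
    obtain ⟨hp, hup⟩ := (cons_isPath_iff h p).mp hp
    obtain ⟨x, hx, q, r, rfl, hq⟩ := p.exists_eq_append_of_end_mem hv
    have hux : u ≠ x := by
      rintro rfl
      exact hup (mem_support_append_iff _ _ |>.mpr (Or.inl q.end_mem_support))
    obtain ⟨hlen, hadj⟩ := hp.of_append_left.length_cons_le_and_adj hW h hu hx hux hq
    simp only [length_cons, length_append] at hl hlen
    obtain ⟨r', hr', hsub, hle⟩ := ih r.length (by omega) hp.of_append_right hx rfl
    have hadj' : (G.induce W).Adj ⟨u, hu⟩ ⟨x, hx⟩ := hadj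
    refine ⟨cons hadj' r', hr'.cons fun hm => hup ?_, ?_, ?_⟩
    · exact (mem_support_append_iff _ _).mpr (Or.inr (hsub _ hm))
    · intro w hw
      rw [support_cons, List.mem_cons] at hw ⊢
      rcases hw with rfl | hw
      · exact Or.inl rfl
      · exact Or.inr ((mem_support_append_iff _ _).mpr (Or.inr (hsub _ hw)))
    · rw [length_cons, mul_add, mul_one]
      omega

end Shortcut

end SimpleGraph.Walk

/-- Let `W` be a set of vertices of `G` such that (i) every path between two distinct vertices
of `W` all of whose internal vertices avoid `W` and having at least one internal vertex has at
most three internal vertices, and its endpoints are adjacent in `G`; (ii) every connected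
component of `G − W` has at most three vertices; (iii) the induced subgraph `G[W]` contains a
cycle. Then for every cycle `C` of `G` there is a cycle `C'` of `G[W]` with
`|V(C)| ≤ 4 · |V(C')|` (the number of vertices of a cycle equals its length). -/
theorem cycle_length_bound_of_induced {V : Type*} [Fintype V] [DecidableEq V]
    (G : SimpleGraph V) (W : Set V)
    (h1 : ∀ u ∈ W, ∀ v ∈ W, u ≠ v → ∀ p : G.Walk u v, p.IsPath →
      (∀ w ∈ p.support.tail.dropLast, w ∉ W) → p.support.tail.dropLast ≠ [] →
      p.support.tail.dropLast.length ≤ 3 ∧ G.Adj u v)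
    (h2 : ∀ c : (G.induce Wᶜ).ConnectedComponent, c.supp.ncard ≤ 3)
    (h3 : ∃ (w : W) (p : (G.induce W).Walk w w), p.IsCycle) :
    ∀ (a : V) (C : G.Walk a a), C.IsCycle →
      ∃ (b : W) (C' : (G.induce W).Walk b b), C'.IsCycle ∧ C.length ≤ 4 * C'.length := by
  intro a C hC
  obtain ⟨b, D, hD⟩ := h3
  have hD3 := hD.three_le_length
  by_cases hCW : ∃ w ∈ C.support, w ∈ W
  · obtain ⟨u, huC, hu⟩ := hCW
    have hrot := hC.rotate huC
    rw [← Walk.length_rotate C u huC]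
    generalize C.rotate u huC = C₁ at hrot
    cases C₁ with
    | nil => exact (Walk.not_isCycle_nil hrot).elim
    | @cons _ y _ h p =>
      have hp := ((Walk.cons_isCycle_iff p h).mp hrot).1
      obtain ⟨x, hx, q, r, rfl, hq⟩ := p.exists_eq_append_of_end_mem hu
      by_cases hux : u = x
      · subst hux
        obtain rfl := (Walk.isPath_iff_nil.mp hp.of_append_right).eq_nil
        have hqnil : ¬ q.Nil := fun hnil => h.ne hnil.eq.symm
        have := hp.of_append_left.dropLast.length_lt_of_support_subset h2
          (by simpa [Walk.support_dropLast hqnil] using hq)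
        rw [Walk.length_dropLast] at this
        refine ⟨b, D, hD, ?_⟩
        simp only [Walk.length_cons, Walk.append_nil]
        omega
      · obtain ⟨hlen, hadj⟩ := hp.of_append_left.length_cons_le_and_adj h1 h hu hx hux hq
        obtain ⟨r', hr', -, hle⟩ := hp.of_append_right.exists_isPath_induce h1 hx hu
        rw [Walk.length_cons] at hlen
        have hadj' : (G.induce W).Adj ⟨u, hu⟩ ⟨x, hx⟩ := hadj
        by_cases hr2 : 2 ≤ r'.length
        · refine ⟨_, _, hr'.isCycle_cons hadj' hr2, ?_⟩
          simp only [Walk.length_cons, Walk.length_append]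
          omega
        · refine ⟨b, D, hD, ?_⟩
          simp only [Walk.length_cons, Walk.length_append]
          omega
  · push Not at hCW
    have := hC.isPath_tail.length_lt_of_support_subset h2
      (fun w hw => hCW w (by
        rw [Walk.support_tail_of_not_nil _ hC.not_nil] at hw
        exact List.mem_of_mem_tail hw))
    have htail := Walk.length_tail_add_one hC.not_nil
    exact ⟨b, D, hD, by omega⟩
end
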